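/- arXiv:math/0105049 — 5 statements merged into one kernel-verified Lean document; each statement's English description precedes it below -/
import Mathlib

section
/- For every nonempty compact Hausdorff topological space X, the Globe Glob(X) is a po-space: the relation ≤ on Glob(X) is reflexive, transitive and antisymmetric (a partial order), and its graph {(a,b) ∈ Glob(X) × Glob(X) : a ≤ b} is a closed subset of Glob(X) × Glob(X). -/
universe u

/-- The relation on `X × [0,1]` identifying `(x,0) ∼ (x',0)` and `(x,1) ∼ (x',1)`. -/
def globR (X : Type u) : X × unitInterval → X × unitInterval → Prop :=
  fun p q => (p.2 = 0 ∧ q.2 = 0) ∨ (p.2 = 1 ∧ q.2 = 1)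

/-- The Globe of a topological space `X` : the quotient of `X × [0,1]` by the
identifications `(x,0) ∼ (x',0)` and `(x,1) ∼ (x',1)`. -/
def Glob (X : Type u) : Type u := Quot (globR X)

/-- The quotient topology on `Glob X`. -/
instance (X : Type u) [TopologicalSpace X] : TopologicalSpace (Glob X) :=
  TopologicalSpace.coinduced (Quot.mk (globR X)) inferInstance

/-- The quotient map `q : X × [0,1] → Glob X`. -/
def globQ {X : Type u} (p : X × unitInterval) : Glob X := Quot.mk (globR X) p

/-- The relation `≤` on `Glob X` : `a ≤ b` iff there are `x ∈ X` and `t ≤ t'` in `[0,1]`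
with `a = q(x,t)` and `b = q(x,t')`. -/
def globLe {X : Type u} (a b : Glob X) : Prop :=
  ∃ (x : X) (t t' : unitInterval), t ≤ t' ∧ a = globQ (x, t) ∧ b = globQ (x, t')

theorem globQ_eq_iff {X : Type u} {p q : X × unitInterval} :
    globQ p = globQ q ↔ p = q ∨ globR X p q := by
  constructor
  · intro h
    induction Quot.eqvGen_exact h with
    | rel p q hpq => exact .inr hpq
    | refl p => exact .inl rfl
    | symm p q _ ih =>
      rcases ih (Quot.eqvGen_sound ‹_›) with rfl | ⟨h₁, h₂⟩ | ⟨h₁, h₂⟩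
      · exact .inl rfl
      · exact .inr (.inl ⟨h₂, h₁⟩)
      · exact .inr (.inr ⟨h₂, h₁⟩)
    | trans p q r _ _ ih₁ ih₂ =>
      rcases ih₁ (Quot.eqvGen_sound ‹_›) with rfl | h₁
      · exact ih₂ (Quot.eqvGen_sound ‹_›)
      rcases ih₂ (Quot.eqvGen_sound ‹_›) with rfl | h₂
      · exact .inr h₁
      right
      rcases h₁ with ⟨h₁, h₁'⟩ | ⟨h₁, h₁'⟩ <;> rcases h₂ with ⟨h₂, h₂'⟩ | ⟨h₂, h₂'⟩
      · exact .inl ⟨h₁, h₂'⟩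
      · exact absurd (h₁'.symm.trans h₂) zero_ne_one
      · exact absurd (h₂.symm.trans h₁') zero_ne_one
      · exact .inr ⟨h₁, h₂'⟩
  · rintro (rfl | h)
    · rfl
    · exact Quot.sound h

theorem globQ_eq_snd {X : Type u} {p q : X × unitInterval} (h : globQ p = globQ q) :
    p.2 = q.2 := by
  rcases globQ_eq_iff.1 h with rfl | ⟨h₁, h₂⟩ | ⟨h₁, h₂⟩
  · rfl
  · rw [h₁, h₂]
  · rw [h₁, h₂]

theorem globQ_surjective {X : Type u} : Function.Surjective (globQ (X := X)) :=
  Quot.mk_surjective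

theorem isQuotientMap_globQ {X : Type u} [TopologicalSpace X] :
    Topology.IsQuotientMap (globQ (X := X)) :=
  ⟨⟨rfl⟩, globQ_surjective⟩

theorem globLe_refl {X : Type u} (a : Glob X) : globLe a a := by
  obtain ⟨⟨x, t⟩, rfl⟩ := globQ_surjective a
  exact ⟨x, t, t, le_rfl, rfl, rfl⟩

theorem globLe_trans {X : Type u} {a b c : Glob X} (hab : globLe a b) (hbc : globLe b c) :
    globLe a c := by
  obtain ⟨x, t, t', ht, rfl, rfl⟩ := hab
  obtain ⟨y, s, s', hs, h, rfl⟩ := hbc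
  rcases globQ_eq_iff.1 h with h | ⟨h₁, h₂⟩ | ⟨h₁, h₂⟩
  · obtain ⟨rfl, rfl⟩ := Prod.mk.inj h
    exact ⟨x, t, s', ht.trans hs, rfl, rfl⟩
  · obtain rfl : t' = 0 := h₁
    obtain rfl : t = 0 := le_antisymm ht unitInterval.nonneg'
    exact ⟨y, 0, s', unitInterval.nonneg', globQ_eq_iff.2 (.inr (.inl ⟨rfl, rfl⟩)), rfl⟩
  · obtain rfl : s = 1 := h₂
    obtain rfl : s' = 1 := le_antisymm unitInterval.le_one' hs
    exact ⟨x, t, 1, unitInterval.le_one', rfl, globQ_eq_iff.2 (.inr (.inr ⟨rfl, rfl⟩))⟩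

theorem globLe_antisymm {X : Type u} {a b : Glob X} (hab : globLe a b) (hba : globLe b a) :
    a = b := by
  obtain ⟨x, t, t', ht, rfl, rfl⟩ := hab
  obtain ⟨y, s, s', hs, h, h'⟩ := hba
  have h₁ : t' = s := globQ_eq_snd h
  have h₂ : t = s' := globQ_eq_snd h'
  rw [le_antisymm ht (h₁ ▸ h₂ ▸ hs)]

/-- The height `q(x,t) ↦ t` on the Globe. -/
def globHeight {X : Type u} : Glob X → unitInterval :=
  Quot.lift Prod.snd fun _ _ h => globQ_eq_snd (Quot.sound h)

theorem continuous_globHeight {X : Type u} [TopologicalSpace X] :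
    Continuous (globHeight (X := X)) :=
  isQuotientMap_globQ.continuous_iff.2 continuous_snd

/-- The function `q(x,t) ↦ t (1 - t) f(x)` on the Globe. -/
def globBump {X : Type u} (f : X → ℝ) : Glob X → ℝ :=
  Quot.lift (fun p => (p.2 : ℝ) * (1 - p.2) * f p.1) <| by
    rintro p q (⟨h₁, h₂⟩ | ⟨h₁, h₂⟩) <;> simp [h₁, h₂]

theorem continuous_globBump {X : Type u} [TopologicalSpace X] {f : X → ℝ} (hf : Continuous f) :
    Continuous (globBump f) := by
  refine isQuotientMap_globQ.continuous_iff.2 ?_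
  change Continuous fun p : X × unitInterval => (p.2 : ℝ) * (1 - p.2) * f p.1
  fun_prop

theorem t2Space_glob {X : Type u} [TopologicalSpace X] [T4Space X] : T2Space (Glob X) := by
  refine ⟨fun a b hab => ?_⟩
  by_cases hh : globHeight a = globHeight b
  · obtain ⟨⟨x, t⟩, rfl⟩ := globQ_surjective a
    obtain ⟨⟨y, s⟩, rfl⟩ := globQ_surjective b
    obtain rfl : t = s := hh
    have hxy : x ≠ y := by
      rintro rfl
      exact hab rfl
    have ht₀ : t ≠ 0 := fun h => hab (globQ_eq_iff.2 (.inr (.inl ⟨h, h⟩)))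
    have ht₁ : t ≠ 1 := fun h => hab (globQ_eq_iff.2 (.inr (.inr ⟨h, h⟩)))
    obtain ⟨f, hf₀, hf₁, -⟩ := exists_continuous_zero_one_of_isClosed
      (isClosed_singleton (x := x)) (isClosed_singleton (x := y)) (by simpa using hxy)
    refine separated_by_continuous (continuous_globBump f.continuous) ?_
    change (t : ℝ) * (1 - t) * f x ≠ t * (1 - t) * f y
    rw [hf₀ rfl, hf₁ rfl]
    have h₀ : (t : ℝ) ≠ 0 := fun h => ht₀ (Subtype.ext h)
    have h₁ : (1 : ℝ) - t ≠ 0 := fun h => ht₁ (Subtype.ext (sub_eq_zero.1 h).symm)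
    change (t : ℝ) * (1 - t) * 0 ≠ t * (1 - t) * 1
    rw [mul_zero, mul_one]
    exact (mul_ne_zero h₀ h₁).symm
  · exact separated_by_continuous continuous_globHeight hh

theorem isClosed_globLe {X : Type u} [TopologicalSpace X] [CompactSpace X] [T2Space X] :
    IsClosed {p : Glob X × Glob X | globLe p.1 p.2} := by
  have : T2Space (Glob X) := t2Space_glob
  have hq : Continuous (globQ (X := X)) := isQuotientMap_globQ.continuous
  have hK : IsClosed {p : X × unitInterval × unitInterval | p.2.1 ≤ p.2.2} :=
    isClosed_le (by fun_prop) (by fun_prop)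
  have hF : Continuous fun p : X × unitInterval × unitInterval =>
      (globQ (p.1, p.2.1), globQ (p.1, p.2.2)) := by fun_prop
  convert (hK.isCompact.image hF).isClosed using 1
  ext ⟨a, b⟩
  constructor
  · rintro ⟨x, t, t', ht, ha, hb⟩
    exact ⟨(x, t, t'), ht, Prod.ext ha.symm hb.symm⟩
  · rintro ⟨⟨x, t, t'⟩, ht, h⟩
    exact ⟨x, t, t', ht, (congrArg Prod.fst h).symm, (congrArg Prod.snd h).symm⟩

/-- For every nonempty compact Hausdorff space `X`, the Globe `Glob X`
is a po-space: the relation `≤` is reflexive, transitive and antisymmetric, and its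
graph is a closed subset of `Glob X × Glob X`. -/
theorem stmt_0 (X : Type) [TopologicalSpace X] [Nonempty X] [CompactSpace X] [T2Space X] :
    (∀ a : Glob X, globLe a a) ∧
    (∀ a b c : Glob X, globLe a b → globLe b c → globLe a c) ∧
    (∀ a b : Glob X, globLe a b → globLe b a → a = b) ∧
    IsClosed {p : Glob X × Glob X | globLe p.1 p.2} :=
  ⟨globLe_refl, fun _ _ _ => globLe_trans, fun _ _ => globLe_antisymm, isClosed_globLe⟩
end

section
/- Let C be an ω-category and let P C = {x ∈ C : dim x ≥ 1}. Then the operators s_n, t_n and *_n for n ≥ 1 are internal to P C — i.e. for every n ≥ 1: x ∈ P C implies s_n x ∈ P C and t_n x ∈ P C, and for all x, y ∈ P C with t_n x = s_n y one has x *_n y ∈ P C — if and only if C is non-contracting. -/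
universe u v w

/-- An ω-category (globular, strict): a set with source maps `s n`, target maps `t n`,
and partially defined composition `comp n x y h` (defined exactly when `t n x = s n y`),
satisfying the usual axioms. -/
structure OmegaCat (C : Type u) : Type u where
  s : ℕ → C → C
  t : ℕ → C → C
  comp : ∀ (n : ℕ) (x y : C), t n x = s n y → C
  /-- axiom (1) for `s ∘ s` -/
  ss : ∀ m n x, (m < n → s m (s n x) = s m x) ∧ (n ≤ m → s m (s n x) = s n x)
  /-- axiom (1) for `s ∘ t` -/
  st : ∀ m n x, (m < n → s m (t n x) = s m x) ∧ (n ≤ m → s m (t n x) = t n x)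
  /-- axiom (1) for `t ∘ s` -/
  ts : ∀ m n x, (m < n → t m (s n x) = t m x) ∧ (n ≤ m → t m (s n x) = s n x)
  /-- axiom (1) for `t ∘ t` -/
  tt : ∀ m n x, (m < n → t m (t n x) = t m x) ∧ (n ≤ m → t m (t n x) = t n x)
  /-- axiom (2): `(s n x) *ₙ x = x` -/
  comp_src : ∀ n x (h : t n (s n x) = s n x), comp n (s n x) x h = x
  /-- axiom (2): `x *ₙ (t n x) = x` -/
  comp_tgt : ∀ n x (h : t n x = s n (t n x)), comp n x (t n x) h = x
  /-- axiom (3): `s n (x *ₙ y) = s n x` -/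
  s_comp : ∀ n x y (h : t n x = s n y), s n (comp n x y h) = s n x
  /-- axiom (3): `t n (x *ₙ y) = t n y` -/
  t_comp : ∀ n x y (h : t n x = s n y), t n (comp n x y h) = t n y
  /-- axiom (3): for `m ≠ n`, `s m (x *ₙ y) = (s m x) *ₙ (s m y)` -/
  s_comp_ne : ∀ m n x y (h : t n x = s n y) (h' : t n (s m x) = s n (s m y)), m ≠ n →
      s m (comp n x y h) = comp n (s m x) (s m y) h'
  /-- axiom (3): for `m ≠ n`, `t m (x *ₙ y) = (t m x) *ₙ (t m y)` -/
  t_comp_ne : ∀ m n x y (h : t n x = s n y) (h' : t n (t m x) = s n (t m y)), m ≠ n →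
      t m (comp n x y h) = comp n (t m x) (t m y) h'
  /-- axiom (4): associativity -/
  comp_assoc : ∀ n x y z (h₁ : t n x = s n y) (h₂ : t n y = s n z)
      (h₃ : t n (comp n x y h₁) = s n z) (h₄ : t n x = s n (comp n y z h₂)),
      comp n (comp n x y h₁) z h₃ = comp n x (comp n y z h₂) h₄
  /-- axiom (5): interchange law -/
  interchange : ∀ m n x y z w, m ≠ n →
      ∀ (hxy : t n x = s n y) (hzw : t n z = s n w)
        (h₁ : t m (comp n x y hxy) = s m (comp n z w hzw))
        (hxz : t m x = s m z) (hyw : t m y = s m w)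
        (h₂ : t n (comp m x z hxz) = s n (comp m y w hyw)),
        comp m (comp n x y hxy) (comp n z w hzw) h₁
          = comp n (comp m x z hxz) (comp m y w hyw) h₂
  /-- axiom (6): every element has a dimension -/
  dim_exists : ∀ x, ∃ n, s n x = x ∧ t n x = x

namespace OmegaCat

variable {C : Type u} {D : Type v} {E : Type w}

/-- The dimension of `x` : the least `n` with `s n x = x` and `t n x = x`. -/
noncomputable def dim (O : OmegaCat C) (x : C) : ℕ :=
  sInf {n | O.s n x = x ∧ O.t n x = x}

/-- An ω-category is non-contracting when `s 1 x` and `t 1 x` are `1`-dimensional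
for every `x` which is not `0`-dimensional. -/
def NonContracting (O : OmegaCat C) : Prop :=
  ∀ x : C, O.dim x ≠ 0 → O.dim (O.s 1 x) = 1 ∧ O.dim (O.t 1 x) = 1

/-- The path set `P C = {x ∈ C : dim x ≥ 1}`. -/
def PathSet (O : OmegaCat C) : Set C := {x | 1 ≤ O.dim x}

/-- An ω-functor : a map preserving all sources, targets and composites. -/
def IsOmegaFunctor (OC : OmegaCat C) (OD : OmegaCat D) (f : C → D) : Prop :=
  (∀ n x, f (OC.s n x) = OD.s n (f x)) ∧
  (∀ n x, f (OC.t n x) = OD.t n (f x)) ∧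
  (∀ n x y (h : OC.t n x = OC.s n y) (h' : OD.t n (f x) = OD.s n (f y)),
      f (OC.comp n x y h) = OD.comp n (f x) (f y) h')

/-- A non-contracting map : it sends `1`-dimensional elements to `1`-dimensional
elements. -/
def IsNonContractingFun (OC : OmegaCat C) (OD : OmegaCat D) (f : C → D) : Prop :=
  ∀ x, OC.dim x = 1 → OD.dim (f x) = 1

/-- `PO` is the path ω-category structure on `P C` : its operations are the
shifted operations `s (n+1)`, `t (n+1)`, `*_{n+1}` of `O`. -/
def IsPathStructure (O : OmegaCat C) (PO : OmegaCat O.PathSet) : Prop :=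
  (∀ (n : ℕ) (x : O.PathSet), (PO.s n x : C) = O.s (n+1) (x : C)) ∧
  (∀ (n : ℕ) (x : O.PathSet), (PO.t n x : C) = O.t (n+1) (x : C)) ∧
  (∀ (n : ℕ) (x y : O.PathSet) (h : PO.t n x = PO.s n y)
      (h' : O.t (n+1) (x : C) = O.s (n+1) (y : C)),
      (PO.comp n x y h : C) = O.comp (n+1) (x : C) (y : C) h')

/-- The globular homotopy set `π^{gl}_{n+1}(C, φ)`. -/
def glPi (O : OmegaCat C) (n : ℕ) (φ : C) : Set C :=
  {x | O.dim x ≤ n + 1 ∧ ∀ i, 1 ≤ i → i ≤ n → O.s i x = φ ∧ O.t i x = φ}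

end OmegaCat

namespace OmegaCat

variable {C : Type u} (O : OmegaCat C)

theorem dim_le_iff (x : C) (n : ℕ) : O.dim x ≤ n ↔ O.s n x = x ∧ O.t n x = x := by
  have hne : {k | O.s k x = x ∧ O.t k x = x}.Nonempty := O.dim_exists x
  refine ⟨fun h => ?_, fun h => Nat.sInf_le h⟩
  obtain ⟨hs, ht⟩ : O.s (O.dim x) x = x ∧ O.t (O.dim x) x = x := Nat.sInf_mem hne
  have h₁ := (O.ss n (O.dim x) x).2 h
  have h₂ := (O.ts n (O.dim x) x).2 h
  rw [hs] at h₁ h₂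
  exact ⟨h₁, h₂⟩

theorem dim_s_le (n : ℕ) (x : C) : O.dim (O.s n x) ≤ n :=
  (O.dim_le_iff _ n).2 ⟨(O.ss n n x).2 le_rfl, (O.ts n n x).2 le_rfl⟩

theorem dim_t_le (n : ℕ) (x : C) : O.dim (O.t n x) ≤ n :=
  (O.dim_le_iff _ n).2 ⟨(O.st n n x).2 le_rfl, (O.tt n n x).2 le_rfl⟩

theorem mem_pathSet_of_s {n : ℕ} {x : C} (h : O.s n x ∈ O.PathSet) : x ∈ O.PathSet := by
  by_contra hx
  have hx₀ : O.dim x ≤ n := by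
    have : ¬ 1 ≤ O.dim x := hx
    lia
  rw [((O.dim_le_iff x n).1 hx₀).1] at h
  exact hx h

theorem mem_pathSet_of_t {n : ℕ} {x : C} (h : O.t n x ∈ O.PathSet) : x ∈ O.PathSet := by
  by_contra hx
  have hx₀ : O.dim x ≤ n := by
    have : ¬ 1 ≤ O.dim x := hx
    lia
  rw [((O.dim_le_iff x n).1 hx₀).2] at h
  exact hx h

theorem s_one_s {n : ℕ} (hn : 1 ≤ n) (x : C) : O.s 1 (O.s n x) = O.s 1 x := by
  rcases hn.eq_or_lt with rfl | hn
  · exact (O.ss 1 1 x).2 le_rfl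
  · exact (O.ss 1 n x).1 hn

theorem t_one_t {n : ℕ} (hn : 1 ≤ n) (x : C) : O.t 1 (O.t n x) = O.t 1 x := by
  rcases hn.eq_or_lt with rfl | hn
  · exact (O.tt 1 1 x).2 le_rfl
  · exact (O.tt 1 n x).1 hn

variable {O}

theorem NonContracting.s_mem_pathSet (hO : O.NonContracting) {n : ℕ} (hn : 1 ≤ n) {x : C}
    (hx : x ∈ O.PathSet) : O.s n x ∈ O.PathSet := by
  apply O.mem_pathSet_of_s (n := 1)
  rw [O.s_one_s hn]
  exact (hO x (Nat.one_le_iff_ne_zero.1 hx)).1.ge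

theorem NonContracting.t_mem_pathSet (hO : O.NonContracting) {n : ℕ} (hn : 1 ≤ n) {x : C}
    (hx : x ∈ O.PathSet) : O.t n x ∈ O.PathSet := by
  apply O.mem_pathSet_of_t (n := 1)
  rw [O.t_one_t hn]
  exact (hO x (Nat.one_le_iff_ne_zero.1 hx)).2.ge

theorem NonContracting.comp_mem_pathSet (hO : O.NonContracting) {n : ℕ} (hn : 1 ≤ n) {x y : C}
    (hx : x ∈ O.PathSet) (h : O.t n x = O.s n y) : O.comp n x y h ∈ O.PathSet := by
  apply O.mem_pathSet_of_s (n := n)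
  rw [O.s_comp]
  exact hO.s_mem_pathSet hn hx

end OmegaCat

/-- for an ω-category `C`, the operators `s n`, `t n` and `*ₙ` for
`n ≥ 1` are internal to `P C` if and only if `C` is non-contracting. -/
theorem stmt_5 {C : Type u} (O : OmegaCat C) :
    (∀ n : ℕ, 1 ≤ n →
      (∀ x ∈ O.PathSet, O.s n x ∈ O.PathSet ∧ O.t n x ∈ O.PathSet) ∧
      (∀ x ∈ O.PathSet, ∀ y ∈ O.PathSet, ∀ h : O.t n x = O.s n y,
        O.comp n x y h ∈ O.PathSet))
    ↔ O.NonContracting := by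
  refine ⟨fun h x hx => ?_, fun hO n hn => ⟨fun x hx => ?_, fun x hx y _ hxy => ?_⟩⟩
  · obtain ⟨hs, ht⟩ := (h 1 le_rfl).1 x (Nat.one_le_iff_ne_zero.2 hx)
    exact ⟨(O.dim_s_le 1 x).antisymm hs, (O.dim_t_le 1 x).antisymm ht⟩
  · exact ⟨hO.s_mem_pathSet hn hx, hO.t_mem_pathSet hn hx⟩
  · exact hO.comp_mem_pathSet hn hx hxy
end

section
/- Let C be a non-contracting ω-category and let R⁻ be the reflexive, symmetric and transitive closure in P C × P C of the relation {(x, x *_0 y) : x, y ∈ P C, x *_0 y is defined and x *_0 y ∈ P C}. Then the universal problem has a solution: there exist an ω-category D and an ω-functor μ : P C → D (where P C carries its path ω-category structure) such that μ(x) = μ(y) whenever x R⁻ y, and such that for every ω-category E and every ω-functor f : P C → E with f(x) = f(y) whenever x R⁻ y, there exists a unique ω-functor g : D → E with g ∘ μ = f. Moreover D is generated by the image of μ: the only subset of D containing μ(P C) and stable under all the operations s_n, t_n and *_n of D is D itself. -/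
universe u v w

open OmegaCat

/-- The relation `{(x, x *₀ y) : x, y ∈ P C, x *₀ y defined and x *₀ y ∈ P C}`
on `P C`. -/
def R0 {C : Type u} (O : OmegaCat C) : O.PathSet → O.PathSet → Prop :=
  fun a b => ∃ (y : C) (_hy : y ∈ O.PathSet) (h : O.t 0 (a : C) = O.s 0 y),
    O.comp 0 (a : C) y h ∈ O.PathSet ∧ (b : C) = O.comp 0 (a : C) y h

namespace OmegaCat

/-- If `s k x = x` and `t k x = x`, then the same holds at every larger index. -/
theorem fixed_of_le {C : Type u} (O : OmegaCat C) {k m : ℕ} (hkm : k ≤ m) {x : C}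
    (h : O.s k x = x ∧ O.t k x = x) : O.s m x = x ∧ O.t m x = x := by
  constructor
  · have := (O.ss m k x).2 hkm
    rwa [h.1] at this
  · have := (O.ts m k x).2 hkm
    rwa [h.1] at this

theorem comp_congr {C : Type u} (O : OmegaCat C) (n : ℕ) {x x' y y' : C} (hx : x = x')
    (hy : y = y') (h : O.t n x = O.s n y) (h' : O.t n x' = O.s n y') :
    O.comp n x y h = O.comp n x' y' h' := by
  subst hx hy
  rfl

theorem comp_fixed {C : Type u} (O : OmegaCat C) {n k : ℕ} (hk : k ≠ n) {x y : C}
    (hx : O.s k x = x ∧ O.t k x = x) (hy : O.s k y = y ∧ O.t k y = y)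
    (h : O.t n x = O.s n y) :
    O.s k (O.comp n x y h) = O.comp n x y h ∧ O.t k (O.comp n x y h) = O.comp n x y h := by
  constructor
  · rw [O.s_comp_ne k n x y h (by rw [hx.1, hy.1, h]) hk]
    exact O.comp_congr n hx.1 hy.1 _ _
  · rw [O.t_comp_ne k n x y h (by rw [hx.2, hy.2, h]) hk]
    exact O.comp_congr n hx.2 hy.2 _ _

theorem IsOmegaFunctor.composable {C : Type u} {D : Type v} {OC : OmegaCat C} {OD : OmegaCat D}
    {f : C → D} (hf : IsOmegaFunctor OC OD f) {n : ℕ} {x y : C} (h : OC.t n x = OC.s n y) :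
    OD.t n (f x) = OD.s n (f y) := by
  rw [← hf.2.1, ← hf.1, h]

/-- The ω-category structure on a set that embeds in a product of ω-categories, compatibly with
given operations. -/
def ofInjective {D : Type u} {I : Type v} {E : I → Type w} (OE : ∀ i, OmegaCat (E i))
    (ev : D → ∀ i, E i) (inj : Function.Injective ev) (s t : ℕ → D → D)
    (comp : ∀ (n : ℕ) (x y : D), t n x = s n y → D)
    (hs : ∀ n x i, ev (s n x) i = (OE i).s n (ev x i))
    (ht : ∀ n x i, ev (t n x) i = (OE i).t n (ev x i))
    (hc : ∀ n x y h i (h' : (OE i).t n (ev x i) = (OE i).s n (ev y i)),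
      ev (comp n x y h) i = (OE i).comp n (ev x i) (ev y i) h')
    (hdim : ∀ x, ∃ n, ∀ i, (OE i).s n (ev x i) = ev x i ∧ (OE i).t n (ev x i) = ev x i) :
    OmegaCat D :=
  have ext {x y : D} (h : ∀ i, ev x i = ev y i) : x = y := inj (funext h)
  have cmp {n : ℕ} {x y : D} (h : t n x = s n y) (i : I) :
      (OE i).t n (ev x i) = (OE i).s n (ev y i) := by rw [← ht, ← hs, h]
  { s := s
    t := t
    comp := comp
    ss := fun m n x =>
      ⟨fun h => ext fun i => by simp only [hs, ((OE i).ss m n _).1 h],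
        fun h => ext fun i => by simp only [hs, ((OE i).ss m n _).2 h]⟩
    st := fun m n x =>
      ⟨fun h => ext fun i => by simp only [hs, ht, ((OE i).st m n _).1 h],
        fun h => ext fun i => by simp only [hs, ht, ((OE i).st m n _).2 h]⟩
    ts := fun m n x =>
      ⟨fun h => ext fun i => by simp only [hs, ht, ((OE i).ts m n _).1 h],
        fun h => ext fun i => by simp only [hs, ht, ((OE i).ts m n _).2 h]⟩
    tt := fun m n x =>
      ⟨fun h => ext fun i => by simp only [ht, ((OE i).tt m n _).1 h],
        fun h => ext fun i => by simp only [ht, ((OE i).tt m n _).2 h]⟩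
    comp_src := fun n x h => ext fun i => by
      rw [hc n _ _ h i (cmp h i)]
      exact ((OE i).comp_congr n (hs n x i) rfl _ (((OE i).ts n n _).2 le_rfl)).trans
        ((OE i).comp_src n _ _)
    comp_tgt := fun n x h => ext fun i => by
      rw [hc n _ _ h i (cmp h i)]
      exact ((OE i).comp_congr n rfl (ht n x i) _ (((OE i).st n n _).2 le_rfl).symm).trans
        ((OE i).comp_tgt n _ _)
    s_comp := fun n x y h => ext fun i => by
      rw [hs, hc n x y h i (cmp h i), (OE i).s_comp, hs]
    t_comp := fun n x y h => ext fun i => by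
      rw [ht, hc n x y h i (cmp h i), (OE i).t_comp, ht]
    s_comp_ne := fun m n x y h h' hmn => ext fun i => by
      rw [hs, hc n x y h i (cmp h i), hc n _ _ h' i (cmp h' i),
        (OE i).s_comp_ne m n _ _ _ (by have := cmp h' i; rwa [hs, hs] at this) hmn]
      exact (OE i).comp_congr n (hs m x i).symm (hs m y i).symm _ _
    t_comp_ne := fun m n x y h h' hmn => ext fun i => by
      rw [ht, hc n x y h i (cmp h i), hc n _ _ h' i (cmp h' i),
        (OE i).t_comp_ne m n _ _ _ (by have := cmp h' i; rwa [ht, ht] at this) hmn]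
      exact (OE i).comp_congr n (ht m x i).symm (ht m y i).symm _ _
    comp_assoc := fun n x y z h₁ h₂ h₃ h₄ => ext fun i => by
      have e₁ := hc n x y h₁ i (cmp h₁ i)
      have e₂ := hc n y z h₂ i (cmp h₂ i)
      rw [hc n _ _ h₃ i (cmp h₃ i), hc n _ _ h₄ i (cmp h₄ i),
        (OE i).comp_congr n e₁ rfl _ (by rw [← e₁]; exact cmp h₃ i),
        (OE i).comp_congr n rfl e₂ _ (by rw [← e₂]; exact cmp h₄ i)]
      exact (OE i).comp_assoc n _ _ _ _ _ _ _
    interchange := fun m n x y z w hmn hxy hzw h₁ hxz hyw h₂ => ext fun i => by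
      have e₁ := hc n x y hxy i (cmp hxy i)
      have e₂ := hc n z w hzw i (cmp hzw i)
      have e₃ := hc m x z hxz i (cmp hxz i)
      have e₄ := hc m y w hyw i (cmp hyw i)
      rw [hc m _ _ h₁ i (cmp h₁ i), hc n _ _ h₂ i (cmp h₂ i),
        (OE i).comp_congr m e₁ e₂ _ (by rw [← e₁, ← e₂]; exact cmp h₁ i),
        (OE i).comp_congr n e₃ e₄ _ (by rw [← e₃, ← e₄]; exact cmp h₂ i)]
      exact (OE i).interchange m n _ _ _ _ hmn _ _ _ _ _ _
    dim_exists := fun x => by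
      obtain ⟨n, hn⟩ := hdim x
      exact ⟨n, ext fun i => by rw [hs, (hn i).1], ext fun i => by rw [ht, (hn i).2]⟩ }

/-- An ω-category that receives an ω-functor from `P` identifying `r`-related elements. -/
structure Receiver {P : Type u} (OP : OmegaCat P) (r : P → P → Prop) : Type (u + 1) where
  carrier : Type u
  cat : OmegaCat carrier
  map : P → carrier
  isOmegaFunctor : IsOmegaFunctor OP cat map
  map_eq : ∀ x y, r x y → map x = map y

/-- Formal expressions in the operations of an ω-category with generators in `P`. -/
inductive Expr (P : Type u) : Type u
  | of (x : P) : Expr P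
  | src (n : ℕ) (a : Expr P) : Expr P
  | tgt (n : ℕ) (a : Expr P) : Expr P
  | comp (n : ℕ) (a b : Expr P) : Expr P

section Universal

variable {P : Type u} {OP : OmegaCat P} {r : P → P → Prop}

variable (OP r) in
open Classical in
/-- The simultaneous value of an expression in all receivers. A composite that is not defined in
every receiver is given the value of its first factor. -/
noncomputable def Expr.eval : Expr P → ∀ M : Receiver OP r, M.carrier
  | .of x => fun M => M.map x
  | .src n a => fun M => M.cat.s n (a.eval M)
  | .tgt n a => fun M => M.cat.t n (a.eval M)
  | .comp n a b =>
    if h : ∀ M : Receiver OP r, M.cat.t n (a.eval M) = M.cat.s n (b.eval M) then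
      fun M => M.cat.comp n (a.eval M) (b.eval M) (h M)
    else a.eval

theorem Expr.exists_fixed (a : Expr P) : ∃ n, ∀ M : Receiver OP r,
    M.cat.s n (a.eval OP r M) = a.eval OP r M ∧ M.cat.t n (a.eval OP r M) = a.eval OP r M := by
  induction a with
  | of x =>
    obtain ⟨n, hs, ht⟩ := OP.dim_exists x
    refine ⟨n, fun M => ?_⟩
    simp only [Expr.eval]
    rw [← M.isOmegaFunctor.1, ← M.isOmegaFunctor.2.1, hs, ht]
    exact ⟨rfl, rfl⟩
  | src n a _ => exact ⟨n, fun M => ⟨(M.cat.ss n n _).2 le_rfl, (M.cat.ts n n _).2 le_rfl⟩⟩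
  | tgt n a _ => exact ⟨n, fun M => ⟨(M.cat.st n n _).2 le_rfl, (M.cat.tt n n _).2 le_rfl⟩⟩
  | comp n a b iha ihb =>
    obtain ⟨i, hi⟩ := iha
    obtain ⟨j, hj⟩ := ihb
    by_cases h : ∀ M : Receiver OP r, M.cat.t n (a.eval OP r M) = M.cat.s n (b.eval OP r M)
    · refine ⟨i + j + n + 1, fun M => ?_⟩
      simp only [Expr.eval, dif_pos h]
      exact M.cat.comp_fixed (by omega) (M.cat.fixed_of_le (by omega) (hi M))
        (M.cat.fixed_of_le (by omega) (hj M)) _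
    · simp only [Expr.eval, dif_neg h]
      exact ⟨i, hi⟩

variable (OP r) in
/-- The underlying set of the universal receiver: expressions up to equality of values. -/
def Universal : Type u := Quotient (Setoid.ker (Expr.eval OP r))

namespace Universal

/-- The class of an expression. -/
noncomputable def mk (a : Expr P) : Universal OP r := Quotient.mk _ a

/-- The value of an element of the universal receiver in a given receiver. -/
noncomputable def ev : Universal OP r → ∀ M : Receiver OP r, M.carrier := Setoid.kerLift _

theorem ev_mk (a : Expr P) : (mk a : Universal OP r).ev = a.eval OP r := rfl

theorem ev_injective : Function.Injective (ev (OP := OP) (r := r)) :=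
  Setoid.kerLift_injective _

theorem eval_out (x : Universal OP r) : (Quotient.out x).eval OP r = x.ev := by
  rw [← ev_mk]
  exact congrArg ev (Quotient.out_eq x)

theorem ev_mk_comp {n : ℕ} {a b : Expr P}
    (h : ∀ M : Receiver OP r, M.cat.t n (a.eval OP r M) = M.cat.s n (b.eval OP r M))
    (M : Receiver OP r) :
    (mk (.comp n a b) : Universal OP r).ev M =
      M.cat.comp n (a.eval OP r M) (b.eval OP r M) (h M) := by
  rw [ev_mk, Expr.eval, dif_pos h]

/-- The source operations of the universal receiver. -/
noncomputable def src (n : ℕ) (x : Universal OP r) : Universal OP r := mk (.src n (Quotient.out x))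

/-- The target operations of the universal receiver. -/
noncomputable def tgt (n : ℕ) (x : Universal OP r) : Universal OP r := mk (.tgt n (Quotient.out x))

theorem ev_src (n : ℕ) (x : Universal OP r) (M : Receiver OP r) :
    (src n x).ev M = M.cat.s n (x.ev M) := by
  rw [src, ev_mk, Expr.eval, eval_out]

theorem ev_tgt (n : ℕ) (x : Universal OP r) (M : Receiver OP r) :
    (tgt n x).ev M = M.cat.t n (x.ev M) := by
  rw [tgt, ev_mk, Expr.eval, eval_out]

theorem ev_composable {n : ℕ} {x y : Universal OP r} (h : tgt n x = src n y)
    (M : Receiver OP r) : M.cat.t n (x.ev M) = M.cat.s n (y.ev M) := by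
  rw [← ev_tgt, ← ev_src, h]

theorem ev_comp {n : ℕ} {x y : Universal OP r} (h : tgt n x = src n y) (M : Receiver OP r) :
    (mk (.comp n (Quotient.out x) (Quotient.out y)) : Universal OP r).ev M =
      M.cat.comp n (x.ev M) (y.ev M) (ev_composable h M) := by
  rw [ev_mk_comp (fun N => by rw [eval_out, eval_out]; exact ev_composable h N)]
  exact M.cat.comp_congr n (congrFun (eval_out x) M) (congrFun (eval_out y) M) _ _

variable (OP r) in
/-- The ω-category structure of the universal receiver. -/
noncomputable def cat : OmegaCat (Universal OP r) :=
  ofInjective (fun M : Receiver OP r => M.cat) ev ev_injective src tgt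
    (fun n x y _ => mk (.comp n (Quotient.out x) (Quotient.out y))) ev_src ev_tgt
    (fun _ _ _ h M _ => ev_comp h M)
    (fun x => by
      rw [← eval_out]
      exact Expr.exists_fixed _)

theorem ev_cat_s (n : ℕ) (x : Universal OP r) (M : Receiver OP r) :
    ((cat OP r).s n x).ev M = M.cat.s n (x.ev M) := ev_src n x M

theorem ev_cat_t (n : ℕ) (x : Universal OP r) (M : Receiver OP r) :
    ((cat OP r).t n x).ev M = M.cat.t n (x.ev M) := ev_tgt n x M

theorem ev_cat_comp {n : ℕ} {x y : Universal OP r} (h : (cat OP r).t n x = (cat OP r).s n y)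
    (M : Receiver OP r) :
    ((cat OP r).comp n x y h).ev M = M.cat.comp n (x.ev M) (y.ev M) (ev_composable h M) :=
  ev_comp h M

theorem isOmegaFunctor_ev (M : Receiver OP r) :
    IsOmegaFunctor (cat OP r) M.cat (fun x => x.ev M) :=
  ⟨fun n x => ev_cat_s n x M, fun n x => ev_cat_t n x M, fun _ _ _ h _ => ev_cat_comp h M⟩

variable (OP r) in
/-- The universal map to the universal receiver. -/
noncomputable def unit (x : P) : Universal OP r := mk (.of x)

theorem ev_unit (x : P) (M : Receiver OP r) : (unit OP r x).ev M = M.map x := rfl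

theorem isOmegaFunctor_unit : IsOmegaFunctor OP (cat OP r) (unit OP r) := by
  refine ⟨fun n x => ev_injective (funext fun M => ?_),
    fun n x => ev_injective (funext fun M => ?_),
    fun n x y h h' => ev_injective (funext fun M => ?_)⟩
  · rw [ev_cat_s, ev_unit, ev_unit, M.isOmegaFunctor.1]
  · rw [ev_cat_t, ev_unit, ev_unit, M.isOmegaFunctor.2.1]
  · rw [ev_cat_comp]
    exact M.isOmegaFunctor.2.2 n x y h (M.isOmegaFunctor.composable h)

theorem unit_eq {x y : P} (h : r x y) : unit OP r x = unit OP r y :=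
  ev_injective (funext fun M => M.map_eq x y h)

theorem eq_univ_of_stable (S : Set (Universal OP r)) (hS : Set.range (unit OP r) ⊆ S)
    (hst : ∀ (n : ℕ), ∀ x ∈ S, (cat OP r).s n x ∈ S ∧ (cat OP r).t n x ∈ S)
    (hc : ∀ (n : ℕ), ∀ x ∈ S, ∀ y ∈ S, ∀ h : (cat OP r).t n x = (cat OP r).s n y,
      (cat OP r).comp n x y h ∈ S) :
    S = Set.univ := by
  have key (a : Expr P) : mk a ∈ S := by
    induction a with
    | of x => exact hS ⟨x, rfl⟩
    | src n a ih =>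
      convert (hst n _ ih).1 using 1
      exact ev_injective (funext fun M => (ev_cat_s n (mk a) M).symm)
    | tgt n a ih =>
      convert (hst n _ ih).2 using 1
      exact ev_injective (funext fun M => (ev_cat_t n (mk a) M).symm)
    | comp n a b iha ihb =>
      by_cases h : ∀ M : Receiver OP r, M.cat.t n (a.eval OP r M) = M.cat.s n (b.eval OP r M)
      · have h' : (cat OP r).t n (mk a) = (cat OP r).s n (mk b) :=
          ev_injective (funext fun M => by
            rw [ev_cat_s, ev_cat_t]
            exact h M)
        convert hc n _ iha _ ihb h' using 1
        refine ev_injective (funext fun M => ?_)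
        rw [ev_mk_comp h, ev_cat_comp]
        rfl
      · convert iha using 1
        refine ev_injective ?_
        rw [ev_mk, ev_mk, Expr.eval, dif_neg h]
  refine Set.eq_univ_of_forall fun x => ?_
  induction x using Quotient.ind
  exact key _

theorem eq_of_comp_unit_eq {E : Type v} {OE : OmegaCat E} {g g' : Universal OP r → E}
    (hg : IsOmegaFunctor (cat OP r) OE g) (hg' : IsOmegaFunctor (cat OP r) OE g')
    (h : g ∘ unit OP r = g' ∘ unit OP r) : g = g' := by
  have hS : {x | g x = g' x} = Set.univ := by
    refine eq_univ_of_stable _ ?_ ?_ ?_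
    · rintro _ ⟨x, rfl⟩
      exact congrFun h x
    · intro n x hx
      change g x = g' x at hx
      change g _ = g' _ ∧ g _ = g' _
      rw [hg.1, hg'.1, hg.2.1, hg'.2.1, hx]
      exact ⟨rfl, rfl⟩
    · intro n x hx y hy hxy
      change g _ = g' _
      rw [hg.2.2 n x y hxy (hg.composable hxy), hg'.2.2 n x y hxy (hg'.composable hxy)]
      exact OE.comp_congr n hx hy _ _
  exact funext (Set.eq_univ_iff_forall.1 hS)

end Universal

end Universal

end OmegaCat

/-- for a non-contracting ω-category `C`, with `R⁻` the reflexive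
symmetric transitive closure of `R0` on `P C`, the universal problem has a solution
`(D, μ)` : `μ : P C → D` is an ω-functor identifying `R⁻`-related elements, universal
among such ω-functors, and `D` is generated by the image of `μ`. -/
theorem stmt_8 {C : Type u} (O : OmegaCat C) (hO : O.NonContracting)
    (PC : OmegaCat O.PathSet) (hPC : O.IsPathStructure PC) :
    ∃ (D : Type u) (OD : OmegaCat D) (μ : O.PathSet → D),
      IsOmegaFunctor PC OD μ ∧
      (∀ x y : O.PathSet, Relation.EqvGen (R0 O) x y → μ x = μ y) ∧
      (∀ (E : Type u) (OE : OmegaCat E) (f : O.PathSet → E),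
        IsOmegaFunctor PC OE f →
        (∀ x y : O.PathSet, Relation.EqvGen (R0 O) x y → f x = f y) →
        ∃! g : D → E, IsOmegaFunctor OD OE g ∧ g ∘ μ = f) ∧
      (∀ S : Set D, Set.range μ ⊆ S →
        (∀ (n : ℕ), ∀ x ∈ S, OD.s n x ∈ S ∧ OD.t n x ∈ S) →
        (∀ (n : ℕ), ∀ x ∈ S, ∀ y ∈ S, ∀ h : OD.t n x = OD.s n y, OD.comp n x y h ∈ S) →
        S = Set.univ) := by
  refine ⟨Universal PC (Relation.EqvGen (R0 O)), Universal.cat _ _, Universal.unit _ _,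
    Universal.isOmegaFunctor_unit, fun _ _ => Universal.unit_eq, fun E OE f hf hr => ?_,
    Universal.eq_univ_of_stable⟩
  let M : Receiver PC (Relation.EqvGen (R0 O)) := ⟨E, OE, f, hf, hr⟩
  exact ⟨fun x => x.ev M, ⟨Universal.isOmegaFunctor_ev M, rfl⟩, fun g hg =>
    Universal.eq_of_comp_unit_eq hg.1 (Universal.isOmegaFunctor_ev M) hg.2⟩
end

section
/- Let C be a non-contracting ω-category, let n ≥ 1, and let φ, ψ ∈ C be 1-dimensional elements with t_0 φ = s_0 ψ (so that φ *_0 ψ is defined). Suppose φ *_0 ψ is 0-dimensional. Then for all x ∈ π^{gl}_{n+1}(C, φ) and y ∈ π^{gl}_{n+1}(C, ψ), the composite x *_0 y is defined and equals the 0-dimensional element φ *_0 ψ; that is, the map (x, y) ↦ x *_0 y is the constant map with value φ *_0 ψ. -/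
universe u v w

namespace OmegaCat

theorem s_zero_of_dim_eq_zero {C : Type u} (O : OmegaCat C) {x : C} (hx : O.dim x = 0) :
    O.s 0 x = x := by
  have h : O.dim x ∈ {n | O.s n x = x ∧ O.t n x = x} := Nat.sInf_mem (O.dim_exists x)
  rw [hx] at h
  exact h.1

theorem s_of_dim_eq_zero {C : Type u} (O : OmegaCat C) {x : C} (hx : O.dim x = 0) (m : ℕ) :
    O.s m x = x := by
  rw [← O.s_zero_of_dim_eq_zero hx]
  exact (O.ss m 0 x).2 m.zero_le

/-- In a non-contracting ω-category, an element whose `1`-source is `0`-dimensional is equal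
to its `1`-source. -/
theorem NonContracting.eq_s_one {C : Type u} {O : OmegaCat C} (hO : O.NonContracting) {x : C}
    (hx : O.dim (O.s 1 x) = 0) : x = O.s 1 x := by
  have hdim : O.dim x = 0 := by
    by_contra h
    have := (hO x h).1
    omega
  exact (O.s_of_dim_eq_zero hdim 1).symm

end OmegaCat

/-- if `C` is non-contracting, `φ, ψ` are `1`-dimensional with
`t₀ φ = s₀ ψ` and `φ *₀ ψ` is `0`-dimensional, then for all
`x ∈ π^{gl}_{n+1}(C, φ)` and `y ∈ π^{gl}_{n+1}(C, ψ)` the composite `x *₀ y` is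
defined and equals the `0`-dimensional element `φ *₀ ψ` : the map `(x,y) ↦ x *₀ y`
is the constant map with value `φ *₀ ψ`. -/
theorem stmt_12 {C : Type u} (O : OmegaCat C) (hO : O.NonContracting)
    (n : ℕ) (hn : 1 ≤ n) (φ ψ : C) (hφ : O.dim φ = 1) (hψ : O.dim ψ = 1)
    (hc : O.t 0 φ = O.s 0 ψ) (h0 : O.dim (O.comp 0 φ ψ hc) = 0) :
    (∀ x ∈ O.glPi n φ, ∀ y ∈ O.glPi n ψ, O.t 0 x = O.s 0 y) ∧
    (∀ x ∈ O.glPi n φ, ∀ y ∈ O.glPi n ψ, ∀ h : O.t 0 x = O.s 0 y,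
      O.comp 0 x y h = O.comp 0 φ ψ hc) := by
  have src_one {m : ℕ} (hm : 1 ≤ m) {χ z : C} (hz : z ∈ O.glPi m χ) : O.s 1 z = χ :=
    (hz.2 1 le_rfl hm).1
  refine ⟨fun x hx y hy => ?_, fun x hx y hy h => ?_⟩
  · rw [← (O.tt 0 1 x).1 one_pos, (hx.2 1 le_rfl hn).2, hc, ← src_one hn hy,
      (O.ss 0 1 y).1 one_pos]
  · obtain rfl := src_one hn hx
    obtain rfl := src_one hn hy
    have hs := O.s_comp_ne 1 0 x y h hc one_ne_zero
    rw [← hs] at h0 ⊢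
    exact hO.eq_s_one h0
end

section
/- Let G be an ω-category and let D := G ⊔ {α, β} be the disjoint union of the underlying set of G with two new distinct elements α and β. Then there exists exactly one ω-category structure on D such that: (i) the 0-dimensional elements of D are exactly α and β; (ii) s_0 x = α and t_0 x = β in D for every x ∈ G; (iii) for every n ≥ 1, the operations s_n, t_n and *_n of D restrict on G to the operations s_{n-1}, t_{n-1} and *_{n-1} of G (so that the path ω-category P D coincides with G). Moreover this ω-category, denoted Glob(G), is non-contracting. -/
universe u v w

/-- Specification of the Globe `Glob(G) = G ⊔ {α, β}` of an ω-category `G`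
(with `α = Sum.inr false` and `β = Sum.inr true`) :
(i) the `0`-dimensional elements are exactly `α` and `β`;
(ii) `s₀ x = α` and `t₀ x = β` for every `x ∈ G`;
(iii) for every `n ≥ 1` the operations `sₙ`, `tₙ`, `*ₙ` restrict on `G` to the
operations `s_{n-1}`, `t_{n-1}`, `*_{n-1}` of `G`. -/
def GlobSpec {A : Type u} (OG : OmegaCat A) (OD : OmegaCat (A ⊕ Bool)) : Prop :=
  (∀ z : A ⊕ Bool, OD.dim z = 0 ↔ (z = Sum.inr false ∨ z = Sum.inr true)) ∧
  (∀ x : A, OD.s 0 (Sum.inl x) = Sum.inr false ∧ OD.t 0 (Sum.inl x) = Sum.inr true) ∧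
  (∀ (n : ℕ) (x : A), OD.s (n+1) (Sum.inl x) = Sum.inl (OG.s n x) ∧
      OD.t (n+1) (Sum.inl x) = Sum.inl (OG.t n x)) ∧
  (∀ (n : ℕ) (x y : A) (h : OG.t n x = OG.s n y)
      (h' : OD.t (n+1) (Sum.inl x) = OD.s (n+1) (Sum.inl y)),
      OD.comp (n+1) (Sum.inl x) (Sum.inl y) h' = Sum.inl (OG.comp n x y h))

namespace OmegaCat

variable {C : Type u} {A : Type u}

theorem ext_of_ops {O P : OmegaCat C} (hs : ∀ n x, O.s n x = P.s n x)
    (ht : ∀ n x, O.t n x = P.t n x)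
    (hc : ∀ n x y (h : O.t n x = O.s n y) (h' : P.t n x = P.s n y),
      O.comp n x y h = P.comp n x y h') : O = P := by
  obtain ⟨s, t, c⟩ := O
  obtain ⟨s', t', c'⟩ := P
  obtain rfl : s = s' := funext fun n => funext fun x => hs n x
  obtain rfl : t = t' := funext fun n => funext fun x => ht n x
  obtain rfl : c = c' :=
    funext fun n => funext fun x => funext fun y => funext fun h => hc n x y h h
  rfl

theorem dim_spec (O : OmegaCat C) (x : C) : O.s (O.dim x) x = x ∧ O.t (O.dim x) x = x :=
  Nat.sInf_mem (O.dim_exists x)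

theorem dim_le {O : OmegaCat C} {x : C} {n : ℕ} (hs : O.s n x = x) (ht : O.t n x = x) :
    O.dim x ≤ n :=
  Nat.sInf_le ⟨hs, ht⟩

theorem dim_eq_zero_iff (O : OmegaCat C) (x : C) :
    O.dim x = 0 ↔ O.s 0 x = x ∧ O.t 0 x = x := by
  refine ⟨fun h => ?_, fun h => Nat.le_zero.mp (dim_le h.1 h.2)⟩
  have := O.dim_spec x
  rwa [h] at this

theorem s_eq_self_of_dim_eq_zero {O : OmegaCat C} {x : C} (h : O.dim x = 0) (n : ℕ) :
    O.s n x = x := by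
  have hx := ((O.dim_eq_zero_iff x).mp h).1
  have := (O.ss n 0 x).2 n.zero_le
  rwa [hx] at this

theorem t_eq_self_of_dim_eq_zero {O : OmegaCat C} {x : C} (h : O.dim x = 0) (n : ℕ) :
    O.t n x = x := by
  have hx := ((O.dim_eq_zero_iff x).mp h).1
  have := (O.ts n 0 x).2 n.zero_le
  rwa [hx] at this

/-- Composing a cell on the right with a cell equal to its target. -/
theorem comp_eq_left (O : OmegaCat C) {n : ℕ} {x y : C} (h : O.t n x = O.s n y)
    (hy : y = O.t n x) : O.comp n x y h = x := by
  subst hy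
  exact O.comp_tgt n x h

/-- Composing a cell on the left with a cell equal to its source. -/
theorem comp_eq_right (O : OmegaCat C) {n : ℕ} {x y : C} (h : O.t n x = O.s n y)
    (hx : x = O.s n y) : O.comp n x y h = y := by
  subst hx
  exact O.comp_src n y h

/-- The source maps of the globe. -/
def globS (O : OmegaCat A) : ℕ → A ⊕ Bool → A ⊕ Bool
  | _, Sum.inr b => Sum.inr b
  | 0, Sum.inl _ => Sum.inr false
  | n + 1, Sum.inl x => Sum.inl (O.s n x)

/-- The target maps of the globe. -/
def globT (O : OmegaCat A) : ℕ → A ⊕ Bool → A ⊕ Bool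
  | _, Sum.inr b => Sum.inr b
  | 0, Sum.inl _ => Sum.inr true
  | n + 1, Sum.inl x => Sum.inl (O.t n x)

/-- The compositions of the globe. -/
def globComp (O : OmegaCat A) :
    ∀ (n : ℕ) (x y : A ⊕ Bool), O.globT n x = O.globS n y → A ⊕ Bool
  | 0, Sum.inl x, _, _ => Sum.inl x
  | 0, Sum.inr _, y, _ => y
  | n + 1, Sum.inl x, Sum.inl y, h => Sum.inl (O.comp n x y (Sum.inl.inj h))
  | _ + 1, Sum.inl x, Sum.inr _, _ => Sum.inl x
  | _ + 1, Sum.inr b, _, _ => Sum.inr b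

/-- The globe of an ω-category. -/
def glob (O : OmegaCat A) : OmegaCat (A ⊕ Bool) where
  s := O.globS
  t := O.globT
  comp := O.globComp
  ss := by
    rintro (_ | m) (_ | n) (x | b) <;> simp [globS]
    exact O.ss m n x
  st := by
    rintro (_ | m) (_ | n) (x | b) <;> simp [globS, globT]
    exact O.st m n x
  ts := by
    rintro (_ | m) (_ | n) (x | b) <;> simp [globS, globT]
    exact O.ts m n x
  tt := by
    rintro (_ | m) (_ | n) (x | b) <;> simp [globT]
    exact O.tt m n x
  comp_src := by
    rintro (_ | n) (x | b) h <;> simp [globS, globComp]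
    exact O.comp_src n x _
  comp_tgt := by
    rintro (_ | n) (x | b) h <;> simp [globT, globComp]
    exact O.comp_tgt n x _
  s_comp := by
    rintro (_ | n) (x | b) (y | c) h
    case succ.inl.inl => exact congrArg Sum.inl (O.s_comp n x y _)
    all_goals cases h <;> rfl
  t_comp := by
    rintro (_ | n) (x | b) (y | c) h
    case succ.inl.inl => exact congrArg Sum.inl (O.t_comp n x y _)
    all_goals cases h <;> rfl
  s_comp_ne := by
    rintro (_ | m) (_ | n) (x | b) (y | c) h h' hmn
    case succ.succ.inl.inl =>
      exact congrArg Sum.inl (O.s_comp_ne m n x y _ _ (mt (congrArg _) hmn))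
    all_goals first | rfl | exact absurd rfl hmn
  t_comp_ne := by
    rintro (_ | m) (_ | n) (x | b) (y | c) h h' hmn
    case succ.succ.inl.inl =>
      exact congrArg Sum.inl (O.t_comp_ne m n x y _ _ (mt (congrArg _) hmn))
    all_goals first | rfl | exact absurd rfl hmn
  comp_assoc := by
    rintro (_ | n) (x | b) (y | c) (z | d) h₁ h₂ h₃ h₄
    case succ.inl.inl.inl => exact congrArg Sum.inl (O.comp_assoc n x y z _ _ _ _)
    all_goals first | rfl | cases h₁
  interchange := by
    rintro (_ | m) (_ | n) (x | b) (y | c) (z | d) (w | e) hmn hxy hzw h₁ hxz hyw h₂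
    case succ.succ.inl.inl.inl.inl =>
      exact congrArg Sum.inl
        (O.interchange m n x y z w (mt (congrArg _) hmn) _ _ _ _ _ _)
    all_goals
      first
      | rfl
      | exact absurd rfl hmn
      | (try cases hxy) <;> (try cases hzw) <;> cases hxz
  dim_exists := by
    rintro (x | b)
    · obtain ⟨n, hs, ht⟩ := O.dim_exists x
      exact ⟨n + 1, congrArg Sum.inl hs, congrArg Sum.inl ht⟩
    · exact ⟨0, rfl, rfl⟩

theorem globSpec_glob (O : OmegaCat A) : GlobSpec O O.glob := by
  refine ⟨fun z => ?_, fun x => ⟨rfl, rfl⟩, fun n x => ⟨rfl, rfl⟩, fun n x y h h' => rfl⟩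
  rw [dim_eq_zero_iff]
  rcases z with x | _ | _ <;> simp [glob, globS, globT]

theorem dim_inr_of_globSpec {O : OmegaCat A} {P : OmegaCat (A ⊕ Bool)} (hP : GlobSpec O P)
    (b : Bool) : P.dim (Sum.inr b) = 0 :=
  (hP.1 _).mpr (by cases b <;> simp)

theorem eq_glob_of_globSpec {O : OmegaCat A} {P : OmegaCat (A ⊕ Bool)} (hP : GlobSpec O P) :
    P = O.glob := by
  have hs : ∀ n x, P.s n x = O.globS n x := by
    rintro (_ | n) (x | b)
    · exact (hP.2.1 x).1
    · exact s_eq_self_of_dim_eq_zero (dim_inr_of_globSpec hP b) _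
    · exact (hP.2.2.1 n x).1
    · exact s_eq_self_of_dim_eq_zero (dim_inr_of_globSpec hP b) _
  have ht : ∀ n x, P.t n x = O.globT n x := by
    rintro (_ | n) (x | b)
    · exact (hP.2.1 x).2
    · exact t_eq_self_of_dim_eq_zero (dim_inr_of_globSpec hP b) _
    · exact (hP.2.2.1 n x).2
    · exact t_eq_self_of_dim_eq_zero (dim_inr_of_globSpec hP b) _
  refine ext_of_ops hs ht ?_
  intro n x y h h'
  change O.globT n x = O.globS n y at h'
  change _ = O.globComp n x y h'
  rcases x with x | b
  · rcases y with y | c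
    · rcases n with _ | n
      · simp [globS, globT] at h'
      · exact hP.2.2.2 n x y (Sum.inl.inj h') h
    · rcases n with _ | n
      · exact P.comp_eq_left h ((ht _ _).trans h').symm
      · simp [globS, globT] at h'
  · have hb : Sum.inr b = P.s n y := by rw [hs, ← h']; cases n <;> rfl
    rw [P.comp_eq_right h hb]
    rcases n with _ | n
    · rfl
    · rcases y with y | c
      · simp [globS, globT] at h'
      · exact h'.symm

theorem nonContracting_of_globSpec {O : OmegaCat A} {P : OmegaCat (A ⊕ Bool)}
    (hP : GlobSpec O P) : P.NonContracting := by
  have dim_inl (x : A) : P.dim (Sum.inl x) ≠ 0 := by simp [hP.1]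
  rintro (x | b) hx
  · constructor
    · refine le_antisymm (dim_le ((P.ss 1 1 _).2 le_rfl) ((P.ts 1 1 _).2 le_rfl)) ?_
      rw [(hP.2.2.1 0 x).1]
      exact Nat.one_le_iff_ne_zero.mpr (dim_inl _)
    · refine le_antisymm (dim_le ((P.st 1 1 _).2 le_rfl) ((P.tt 1 1 _).2 le_rfl)) ?_
      rw [(hP.2.2.1 0 x).2]
      exact Nat.one_le_iff_ne_zero.mpr (dim_inl _)
  · exact absurd (dim_inr_of_globSpec hP b) hx

end OmegaCat

/-- for every ω-category `G` there is exactly one ω-category structure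
on `D = G ⊔ {α, β}` satisfying (i), (ii), (iii) above; moreover this ω-category
`Glob(G)` is non-contracting. -/
theorem stmt_13 {A : Type u} (OG : OmegaCat A) :
    (∃! OD : OmegaCat (A ⊕ Bool), GlobSpec OG OD) ∧
    (∀ OD : OmegaCat (A ⊕ Bool), GlobSpec OG OD → OD.NonContracting) :=
  ⟨⟨OG.glob, OG.globSpec_glob, fun _ h => OmegaCat.eq_glob_of_globSpec h⟩,
    fun _ h => OmegaCat.nonContracting_of_globSpec h⟩
end
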